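/- For every nonzero integer n and every integer α ≥ 4, there exists a connected finite simple graph with independence number α having independence roots at i/n and −i/n. -/

import Mathlib

open scoped Classical
open Polynomial

/-- `s` is an independent set of the simple graph `G`. -/
def SimpleGraph.IsIndepFinset {V : Type} (G : SimpleGraph V) (s : Finset V) : Prop :=
  ∀ u ∈ s, ∀ v ∈ s, ¬ G.Adj u v

/-- The independence polynomial of `G`, as a polynomial over `ℂ`:
`I(G,x) = ∑_k s_k x^k` where `s_k` is the number of independent sets of cardinality `k`. -/
noncomputable def indepPoly {V : Type} [Fintype V] (G : SimpleGraph V) : Polynomial ℂ :=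
  ∑ s ∈ Finset.univ.filter (fun s : Finset V => G.IsIndepFinset s), (X : Polynomial ℂ) ^ s.card

/-- The independence number of `G`. -/
noncomputable def indepNum {V : Type} [Fintype V] (G : SimpleGraph V) : ℕ :=
  (Finset.univ.filter (fun s : Finset V => G.IsIndepFinset s)).sup Finset.card

/-- The join `G + H` of two graphs: their disjoint union together with
all edges between the two parts. -/
def graphJoin {α β : Type} (G : SimpleGraph α) (H : SimpleGraph β) : SimpleGraph (α ⊕ β) where
  Adj x y :=
    match x, y with
    | Sum.inl a, Sum.inl b => G.Adj a b
    | Sum.inr a, Sum.inr b => H.Adj a b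
    | Sum.inl _, Sum.inr _ => True
    | Sum.inr _, Sum.inl _ => True
  symm := by
    refine ⟨?_⟩
    rintro (a | a) (b | b) h
    · exact G.symm.symm _ _ h
    · trivial
    · trivial
    · exact H.symm.symm _ _ h
  loopless := by
    refine ⟨?_⟩
    rintro (a | a) h
    · exact G.loopless.irrefl a h
    · exact H.loopless.irrefl a h

/-- `mK_n` : the disjoint union of `m` copies of the complete graph `K_n`. -/
def mClique (m n : ℕ) : SimpleGraph (Fin m × Fin n) where
  Adj x y := x.1 = y.1 ∧ x ≠ y
  symm := by refine ⟨?_⟩; rintro x y ⟨h1, h2⟩; exact ⟨h1.symm, h2.symm⟩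
  loopless := by refine ⟨?_⟩; rintro x ⟨_, h⟩; exact h rfl

/-- The lexicographic product `G[H]`. -/
def lexProd {α β : Type} (G : SimpleGraph α) (H : SimpleGraph β) : SimpleGraph (α × β) where
  Adj x y := G.Adj x.1 y.1 ∨ (x.1 = y.1 ∧ H.Adj x.2 y.2)
  symm := by
    refine ⟨?_⟩
    rintro x y (h | ⟨h1, h2⟩)
    · exact Or.inl (G.symm.symm _ _ h)
    · exact Or.inr ⟨h1.symm, H.symm.symm _ _ h2⟩
  loopless := by
    refine ⟨?_⟩
    rintro x (h | ⟨-, h⟩)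
    · exact G.loopless.irrefl _ h
    · exact H.loopless.irrefl _ h

/-- The corona `G ∘ H`: for each vertex `v` of `G`, add a new copy of `H`
joined completely to `v`. -/
def corona {α β : Type} (G : SimpleGraph α) (H : SimpleGraph β) : SimpleGraph (α ⊕ α × β) where
  Adj x y :=
    match x, y with
    | Sum.inl a, Sum.inl b => G.Adj a b
    | Sum.inl a, Sum.inr b => a = b.1
    | Sum.inr a, Sum.inl b => b = a.1
    | Sum.inr a, Sum.inr b => a.1 = b.1 ∧ H.Adj a.2 b.2
  symm := by
    refine ⟨?_⟩
    rintro (a | a) (b | b) h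
    · exact G.symm.symm _ _ h
    · exact h
    · exact h
    · exact ⟨h.1.symm, H.symm.symm _ _ h.2⟩
  loopless := by
    refine ⟨?_⟩
    rintro (a | a) h
    · exact G.loopless.irrefl a h
    · exact H.loopless.irrefl a.2 h.2

theorem indepPoly_eq_sum_ite {V : Type} [Fintype V] (G : SimpleGraph V) :
    indepPoly G = ∑ s : Finset V, if G.IsIndepFinset s then (X : ℂ[X]) ^ s.card else 0 :=
  Finset.sum_filter _ _

theorem indepNum_le_iff {V : Type} [Fintype V] {G : SimpleGraph V} {k : ℕ} :
    indepNum G ≤ k ↔ ∀ s, G.IsIndepFinset s → s.card ≤ k := by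
  simp [indepNum]

theorem SimpleGraph.IsIndepFinset.card_le_indepNum {V : Type} [Fintype V] {G : SimpleGraph V}
    {s : Finset V} (hs : G.IsIndepFinset s) : s.card ≤ _root_.indepNum G :=
  indepNum_le_iff.1 le_rfl s hs

theorem exists_isIndepFinset_card_eq_indepNum {V : Type} [Fintype V] (G : SimpleGraph V) :
    ∃ s, G.IsIndepFinset s ∧ s.card = indepNum G := by
  obtain ⟨s, hs, h⟩ := Finset.exists_mem_eq_sup
    (Finset.univ.filter fun s : Finset V => G.IsIndepFinset s)
    ⟨∅, Finset.mem_filter.2 ⟨Finset.mem_univ _, by simp [SimpleGraph.IsIndepFinset]⟩⟩ Finset.card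
  exact ⟨s, (Finset.mem_filter.1 hs).2, h.symm⟩

theorem SimpleGraph.Iso.isIndepFinset_map {V W : Type} {G : SimpleGraph V} {H : SimpleGraph W}
    (e : G ≃g H) (s : Finset V) :
    H.IsIndepFinset (s.map e.toEquiv.toEmbedding) ↔ G.IsIndepFinset s := by
  simp only [SimpleGraph.IsIndepFinset, Finset.forall_mem_map]
  exact forall₄_congr fun u _ v _ => not_congr e.map_adj_iff

theorem SimpleGraph.Iso.indepPoly_eq {V W : Type} [Fintype V] [Fintype W] {G : SimpleGraph V}
    {H : SimpleGraph W} (e : G ≃g H) : indepPoly G = indepPoly H := by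
  rw [indepPoly_eq_sum_ite, indepPoly_eq_sum_ite]
  refine Fintype.sum_equiv e.toEquiv.finsetCongr _ _ fun s => ?_
  simp [e.isIndepFinset_map]

theorem SimpleGraph.Iso.indepNum_le {V W : Type} [Fintype V] [Fintype W] {G : SimpleGraph V}
    {H : SimpleGraph W} (e : G ≃g H) : _root_.indepNum G ≤ _root_.indepNum H :=
  indepNum_le_iff.2 fun s hs => by
    simpa using ((e.isIndepFinset_map s).2 hs).card_le_indepNum

theorem SimpleGraph.Iso.indepNum_eq {V W : Type} [Fintype V] [Fintype W] {G : SimpleGraph V}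
    {H : SimpleGraph W} (e : G ≃g H) : _root_.indepNum G = _root_.indepNum H :=
  e.indepNum_le.antisymm e.symm.indepNum_le

theorem isIndepFinset_sum_disjSum {α β : Type} {G : SimpleGraph α} {H : SimpleGraph β}
    {s : Finset α} {t : Finset β} :
    (G ⊕g H).IsIndepFinset (s.disjSum t) ↔ G.IsIndepFinset s ∧ H.IsIndepFinset t := by
  simp [SimpleGraph.IsIndepFinset]

theorem isIndepFinset_graphJoin_disjSum {α β : Type} {G : SimpleGraph α} {H : SimpleGraph β}
    {s : Finset α} {t : Finset β} :
    (graphJoin G H).IsIndepFinset (s.disjSum t) ↔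
      (s = ∅ ∧ H.IsIndepFinset t) ∨ (t = ∅ ∧ G.IsIndepFinset s) := by
  rcases s.eq_empty_or_nonempty with rfl | ⟨a, ha⟩
  · simp +contextual [SimpleGraph.IsIndepFinset, graphJoin]
  · rcases t.eq_empty_or_nonempty with rfl | ⟨b, hb⟩
    · simp +contextual [SimpleGraph.IsIndepFinset, graphJoin]
    · simp only [Finset.ne_empty_of_mem ha, Finset.ne_empty_of_mem hb, false_and, or_self,
        iff_false]
      exact fun h => h (Sum.inl a) (by simpa) (Sum.inr b) (by simpa) trivial

theorem indepPoly_eq_sum_disjSum {α β : Type} [Fintype α] [Fintype β]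
    (G : SimpleGraph (α ⊕ β)) :
    indepPoly G = ∑ s : Finset α, ∑ t : Finset β,
      if G.IsIndepFinset (s.disjSum t) then (X : ℂ[X]) ^ (s.card + t.card) else 0 := by
  rw [indepPoly_eq_sum_ite, ← Fintype.sum_prod_type']
  refine Fintype.sum_equiv Finset.sumEquiv.toEquiv _ _ fun s => ?_
  have h : s.toLeft.disjSum s.toRight = s := Finset.toLeft_disjSum_toRight
  simp [h, Finset.card_toLeft_add_card_toRight]

theorem indepNum_le_iff_disjSum {α β : Type} [Fintype α] [Fintype β]
    {G : SimpleGraph (α ⊕ β)} {k : ℕ} :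
    indepNum G ≤ k ↔ ∀ (s : Finset α) (t : Finset β),
      G.IsIndepFinset (s.disjSum t) → s.card + t.card ≤ k := by
  rw [indepNum_le_iff]
  refine ⟨fun h s t hst => by simpa using h _ hst, fun h s hs => ?_⟩
  rw [← Finset.card_toLeft_add_card_toRight]
  exact h _ _ (by rwa [Finset.toLeft_disjSum_toRight])

theorem indepPoly_sum {α β : Type} [Fintype α] [Fintype β] (G : SimpleGraph α)
    (H : SimpleGraph β) : indepPoly (G ⊕g H) = indepPoly G * indepPoly H := by
  rw [indepPoly_eq_sum_disjSum, indepPoly_eq_sum_ite, indepPoly_eq_sum_ite, Finset.sum_mul_sum]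
  refine Finset.sum_congr rfl fun s _ => Finset.sum_congr rfl fun t _ => ?_
  simp only [isIndepFinset_sum_disjSum]
  by_cases hs : G.IsIndepFinset s <;> by_cases ht : H.IsIndepFinset t <;> simp [hs, ht, pow_add]

theorem indepNum_sum {α β : Type} [Fintype α] [Fintype β] (G : SimpleGraph α)
    (H : SimpleGraph β) : indepNum (G ⊕g H) = indepNum G + indepNum H := by
  refine le_antisymm (indepNum_le_iff_disjSum.2 fun s t h => ?_) ?_
  · rw [isIndepFinset_sum_disjSum] at h
    exact add_le_add h.1.card_le_indepNum h.2.card_le_indepNum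
  · obtain ⟨s, hs, hs'⟩ := exists_isIndepFinset_card_eq_indepNum G
    obtain ⟨t, ht, ht'⟩ := exists_isIndepFinset_card_eq_indepNum H
    rw [← hs', ← ht']
    exact indepNum_le_iff_disjSum.1 le_rfl s t (isIndepFinset_sum_disjSum.2 ⟨hs, ht⟩)

theorem indepPoly_graphJoin {α β : Type} [Fintype α] [Fintype β] (G : SimpleGraph α)
    (H : SimpleGraph β) : indepPoly (graphJoin G H) = indepPoly G + indepPoly H - 1 := by
  have key : ∀ (s : Finset α) (t : Finset β),
      (if (graphJoin G H).IsIndepFinset (s.disjSum t) then (X : ℂ[X]) ^ (s.card + t.card) else 0) =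
        (if t = ∅ then (if G.IsIndepFinset s then X ^ s.card else 0) else 0) +
        (if s = ∅ then (if H.IsIndepFinset t then X ^ t.card else 0) else 0) -
        (if s = ∅ then (if t = ∅ then 1 else 0) else 0) := by
    intro s t
    simp only [isIndepFinset_graphJoin_disjSum]
    have hG : G.IsIndepFinset ∅ := by simp [SimpleGraph.IsIndepFinset]
    have hH : H.IsIndepFinset ∅ := by simp [SimpleGraph.IsIndepFinset]
    by_cases hs : s = ∅ <;> by_cases ht : t = ∅ <;> simp [hs, ht, hG, hH]
  rw [indepPoly_eq_sum_disjSum, indepPoly_eq_sum_ite, indepPoly_eq_sum_ite]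
  simp_rw [key, Finset.sum_sub_distrib, Finset.sum_add_distrib]
  congr 1
  · congr 1
    · simp
    · rw [Finset.sum_comm]
      simp
  · rw [Finset.sum_comm]
    simp

theorem indepNum_graphJoin {α β : Type} [Fintype α] [Fintype β] (G : SimpleGraph α)
    (H : SimpleGraph β) : indepNum (graphJoin G H) = max (indepNum G) (indepNum H) := by
  refine le_antisymm (indepNum_le_iff_disjSum.2 fun s t h => ?_) (max_le ?_ ?_)
  · rcases isIndepFinset_graphJoin_disjSum.1 h with ⟨rfl, ht⟩ | ⟨rfl, hs⟩
    · simpa using Or.inr ht.card_le_indepNum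
    · simpa using Or.inl hs.card_le_indepNum
  · exact indepNum_le_iff.2 fun s hs => by
      simpa using indepNum_le_iff_disjSum.1 le_rfl s ∅
        (isIndepFinset_graphJoin_disjSum (G := G) (H := H).2 (Or.inr ⟨rfl, hs⟩))
  · exact indepNum_le_iff.2 fun t ht => by
      simpa using indepNum_le_iff_disjSum.1 le_rfl ∅ t
        (isIndepFinset_graphJoin_disjSum (G := G) (H := H).2 (Or.inl ⟨rfl, ht⟩))

theorem graphJoin_connected {α β : Type} [Nonempty α] [Nonempty β] (G : SimpleGraph α)
    (H : SimpleGraph β) : (graphJoin G H).Connected := by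
  have h : ∀ a b, (graphJoin G H).Reachable (Sum.inl a) (Sum.inr b) := fun a b =>
    SimpleGraph.Adj.reachable (show (graphJoin G H).Adj (Sum.inl a) (Sum.inr b) from trivial)
  obtain ⟨a₀⟩ := ‹Nonempty α›
  obtain ⟨b₀⟩ := ‹Nonempty β›
  have h' : ∀ v, (graphJoin G H).Reachable (Sum.inl a₀) v := by
    rintro (a | b)
    · exact (h a₀ b₀).trans (h a b₀).symm
    · exact h a₀ b
  exact (SimpleGraph.connected_iff_exists_forall_reachable _).2 ⟨_, h'⟩

theorem indepPoly_of_isEmpty {V : Type} [Fintype V] [IsEmpty V] (G : SimpleGraph V) :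
    indepPoly G = 1 := by
  have h : G.IsIndepFinset ∅ := by simp [SimpleGraph.IsIndepFinset]
  rw [indepPoly_eq_sum_ite, Fintype.sum_subsingleton _ ∅, if_pos h, Finset.card_empty, pow_zero]

theorem indepNum_of_isEmpty {V : Type} [Fintype V] [IsEmpty V] (G : SimpleGraph V) :
    indepNum G = 0 :=
  Nat.le_zero.1 (indepNum_le_iff.2 fun s _ => by simp [Finset.eq_empty_of_isEmpty s])

theorem indepPoly_unit (G : SimpleGraph Unit) : indepPoly G = 1 + X := by
  rw [indepPoly_eq_sum_ite, show (Finset.univ : Finset (Finset Unit)) = {∅, {()}} by decide]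
  simp [SimpleGraph.IsIndepFinset]

theorem indepNum_unit (G : SimpleGraph Unit) : indepNum G = 1 := by
  refine le_antisymm (indepNum_le_iff.2 fun s _ => by simpa using Finset.card_le_univ s) ?_
  have h : G.IsIndepFinset {()} := by simp [SimpleGraph.IsIndepFinset]
  simpa using h.card_le_indepNum

theorem indepPoly_eval_conj {V : Type} [Fintype V] (G : SimpleGraph V) (z : ℂ) :
    (indepPoly G).eval (starRingEnd ℂ z) = starRingEnd ℂ ((indepPoly G).eval z) := by
  simp [indepPoly, eval_finsetSum]

/-- Some finite graph has independence polynomial `p` and independence number `k`. -/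
def IsIndepPolyWithNum (p : ℂ[X]) (k : ℕ) : Prop :=
  ∃ (V : Type) (_ : Fintype V) (G : SimpleGraph V), indepPoly G = p ∧ indepNum G = k

namespace IsIndepPolyWithNum

theorem one : IsIndepPolyWithNum 1 0 :=
  ⟨Empty, inferInstance, ⊥, indepPoly_of_isEmpty _, indepNum_of_isEmpty _⟩

theorem one_add_X : IsIndepPolyWithNum (1 + X) 1 :=
  ⟨Unit, inferInstance, ⊥, indepPoly_unit _, indepNum_unit _⟩

theorem join {p q : ℂ[X]} {k l : ℕ} (hp : IsIndepPolyWithNum p k)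
    (hq : IsIndepPolyWithNum q l) : IsIndepPolyWithNum (p + q - 1) (max k l) := by
  obtain ⟨V, _, G, rfl, rfl⟩ := hp
  obtain ⟨W, _, H, rfl, rfl⟩ := hq
  exact ⟨V ⊕ W, inferInstance, graphJoin G H, indepPoly_graphJoin G H, indepNum_graphJoin G H⟩

theorem mul {p q : ℂ[X]} {k l : ℕ} (hp : IsIndepPolyWithNum p k)
    (hq : IsIndepPolyWithNum q l) : IsIndepPolyWithNum (p * q) (k + l) := by
  obtain ⟨V, _, G, rfl, rfl⟩ := hp
  obtain ⟨W, _, H, rfl, rfl⟩ := hq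
  exact ⟨V ⊕ W, inferInstance, G ⊕g H, indepPoly_sum G H, indepNum_sum G H⟩

theorem pow {p : ℂ[X]} {k : ℕ} (hp : IsIndepPolyWithNum p k) (m : ℕ) :
    IsIndepPolyWithNum (p ^ m) (m * k) := by
  induction m with
  | zero => simpa using one
  | succ m ih => simpa [pow_succ, add_mul] using ih.mul hp

theorem clique {N : ℕ} (hN : N ≠ 0) : IsIndepPolyWithNum (1 + (N : ℂ[X]) * X) 1 := by
  induction N, Nat.one_le_iff_ne_zero.2 hN using Nat.le_induction with
  | base => simpa using one_add_X
  | succ N hN ih =>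
    convert (ih (by omega)).join one_add_X using 1
    · push_cast
      ring
    · simp

theorem cliques {N : ℕ} (hN : N ≠ 0) (m : ℕ) :
    IsIndepPolyWithNum ((1 + (N : ℂ[X]) * X) ^ m) m := by
  simpa using (clique hN).pow m

end IsIndepPolyWithNum

/-- The values `I(G, x) - 1`, where `G` ranges over the finite graphs with independence number at
most `α`. They are closed under addition because of joins of graphs. -/
def indepValues (x : ℂ) (α : ℕ) : AddSubmonoid ℂ where
  carrier := {w | ∃ p k, IsIndepPolyWithNum p k ∧ k ≤ α ∧ p.eval x = 1 + w}
  zero_mem' := ⟨1, 0, .one, by simp⟩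
  add_mem' := by
    rintro v w ⟨p, k, hp, hk, hv⟩ ⟨q, l, hq, hl, hw⟩
    refine ⟨_, _, hp.join hq, max_le hk hl, ?_⟩
    simp only [eval_sub, eval_add, eval_one, hv, hw]
    ring

theorem neg_gaussianInt_mem_indepValues {N : ℕ} (hN : N ≠ 0) {α : ℕ} (hα : 4 ≤ α) (a b : ℤ) :
    -(a + b * Complex.I) ∈ indepValues (Complex.I / N) α := by
  have hN' : (N : ℂ) ≠ 0 := Nat.cast_ne_zero.2 hN
  have hI : (N : ℂ) * (Complex.I / N) = Complex.I := by field_simp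
  have h₁ : Complex.I ∈ indepValues (Complex.I / N) α :=
    ⟨_, 1, .clique hN, by omega, by simp [hI]⟩
  have h₂ : -1 + 2 * Complex.I ∈ indepValues (Complex.I / N) α := by
    refine ⟨_, 2, .cliques hN 2, by omega, ?_⟩
    simp only [eval_pow, eval_add, eval_one, eval_mul, eval_natCast, eval_X, hI]
    linear_combination Complex.I_sq
  have h₃ : 27 - 96 * Complex.I ∈ indepValues (Complex.I / N) α := by
    refine ⟨_, 4, .cliques (N := 3 * N) (by omega) 4, hα, ?_⟩
    simp only [eval_pow, eval_add, eval_one, eval_mul, eval_natCast, eval_X, Nat.cast_mul,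
      mul_assoc, hI]
    push_cast
    linear_combination (81 * Complex.I ^ 2 + 108 * Complex.I - 27) * Complex.I_sq
  obtain ⟨c, hc⟩ := Int.eq_ofNat_of_zero_le (add_nonneg (abs_nonneg a) (abs_nonneg b))
  obtain ⟨μ, hμ⟩ := Int.eq_ofNat_of_zero_le (show 0 ≤ 27 * (c : ℤ) + a by
    rw [← hc]; linarith [neg_abs_le a, abs_nonneg a, abs_nonneg b])
  obtain ⟨l, hl⟩ := Int.eq_ofNat_of_zero_le (show 0 ≤ 42 * (c : ℤ) - 2 * a - b by
    rw [← hc]; linarith [le_abs_self a, le_abs_self b, abs_nonneg a, abs_nonneg b])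
  have hμ' : 27 * (c : ℂ) + a = μ := by exact_mod_cast congrArg (Int.cast : ℤ → ℂ) hμ
  have hl' : 42 * (c : ℂ) - 2 * a - b = l := by exact_mod_cast congrArg (Int.cast : ℤ → ℂ) hl
  convert add_mem (add_mem (nsmul_mem h₃ c) (nsmul_mem h₂ μ)) (nsmul_mem h₁ l) using 1
  simp only [nsmul_eq_mul]
  rw [← hμ', ← hl']
  ring

theorem exists_one_add_I_pow_eq (m : ℕ) :
    ∃ a b : ℤ, (1 + Complex.I) ^ m = a + b * Complex.I := by
  induction m with
  | zero => exact ⟨1, 0, by simp⟩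
  | succ m ih =>
    obtain ⟨a, b, h⟩ := ih
    refine ⟨a - b, a + b, ?_⟩
    rw [pow_succ, h]
    push_cast
    linear_combination (b : ℂ) * Complex.I_sq

theorem exists_connected_graph_with_root_I_div_natCast {N : ℕ} (hN : N ≠ 0) {α : ℕ}
    (hα : 4 ≤ α) :
    ∃ (m : ℕ) (G : SimpleGraph (Fin m)), G.Connected ∧ indepNum G = α ∧
      (indepPoly G).eval (Complex.I / N) = 0 := by
  have hI : (N : ℂ) * (Complex.I / N) = Complex.I := by
    have hN' : (N : ℂ) ≠ 0 := Nat.cast_ne_zero.2 hN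
    field_simp
  obtain ⟨V, _, G, hG, hGα⟩ := IsIndepPolyWithNum.cliques hN α
  obtain ⟨a, b, hab⟩ := exists_one_add_I_pow_eq α
  obtain ⟨_, _, ⟨W, _, H, rfl, rfl⟩, hHα, hH⟩ := neg_gaussianInt_mem_indepValues hN hα a b
  have hGx : (indepPoly G).eval (Complex.I / N) = (1 + Complex.I) ^ α := by simp [hG, hI]
  have : Nonempty V := by
    by_contra h
    rw [not_nonempty_iff] at h
    rw [indepNum_of_isEmpty] at hGα
    omega
  have : Nonempty W := by
    by_contra h
    rw [not_nonempty_iff] at h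
    rw [indepPoly_of_isEmpty, ← hab, eval_one, left_eq_add, neg_eq_zero] at hH
    have h0 := congrArg Complex.re (pow_eq_zero_iff (by omega) |>.1 hH)
    simp at h0
  let e := (graphJoin G H).overFinIso (n := Fintype.card (V ⊕ W)) rfl
  refine ⟨_, (graphJoin G H).overFin rfl, e.connected_iff.1 (graphJoin_connected G H), ?_, ?_⟩
  · rw [← e.indepNum_eq, indepNum_graphJoin, hGα, max_eq_left hHα]
  · rw [← e.indepPoly_eq, indepPoly_graphJoin, eval_sub, eval_add, eval_one, hGx, hH, hab]
    ring

/-- For every nonzero integer `n` and every integer `α ≥ 4`, there exists a connected finite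
simple graph with independence number `α` having independence roots at `i/n` and `−i/n`. -/
theorem exists_connected_graph_with_root_I_div_n (n : ℤ) (hn : n ≠ 0) (α : ℕ) (hα : 4 ≤ α) :
    ∃ (m : ℕ) (G : SimpleGraph (Fin m)),
      G.Connected ∧ indepNum G = α ∧
      (indepPoly G).eval (Complex.I / n) = 0 ∧
      (indepPoly G).eval (-(Complex.I / n)) = 0 := by
  obtain ⟨m, G, hG, hGα, h⟩ :=
    exists_connected_graph_with_root_I_div_natCast (Int.natAbs_ne_zero.2 hn) hα
  have h' : (indepPoly G).eval (-(Complex.I / n.natAbs)) = 0 := by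
    have := indepPoly_eval_conj G (Complex.I / n.natAbs)
    rw [h, map_zero] at this
    simpa [neg_div] using this
  refine ⟨m, G, hG, hGα, ?_⟩
  obtain ⟨N, rfl | rfl⟩ := n.eq_nat_or_neg
  · simp only [Int.natAbs_natCast, Int.cast_natCast] at h h' ⊢
    exact ⟨h, h'⟩
  · simp only [Int.natAbs_neg, Int.natAbs_natCast, Int.cast_neg, Int.cast_natCast, div_neg,
      neg_neg] at h h' ⊢
    exact ⟨h', h⟩
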